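/- Let F_q be a finite field, 0 ≤ M < K, and let H be a (K−M)×K matrix over F_q such that every set of K−M columns of H is linearly independent (i.e., H is a parity check matrix of a (K,M) MDS code). Then H satisfies the (W,S)-PIR-SI condition with side-information size M: for every set S ⊆ {1,…,K} with |S| = M and every i ∈ {1,…,K}\S, the unit vector e_i lies in the span of the rows of H together with the unit vectors e_j, j ∈ S. -/

import Mathlib

/-- The span of the rows of `H` together with the unit vectors `e_j`, `j ∈ S`. -/
def rowUnitSpan (F : Type*) [Field F] {T K : ℕ} (H : Matrix (Fin T) (Fin K) F)
    (S : Finset (Fin K)) : Submodule F (Fin K → F) :=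
  Submodule.span F
    (Set.range (fun t => H t) ∪ (fun j => Pi.single j (1 : F)) '' (S : Set (Fin K)))

/-- A vector agreeing outside `S` with a linear combination of the rows of `H` lies in the span of
the rows together with the unit vectors `e_j`, `j ∈ S`. -/
theorem mem_rowUnitSpan_of_eq_sum_off {F : Type*} [Field F] {T K : ℕ}
    {H : Matrix (Fin T) (Fin K) F} {S : Finset (Fin K)} {v : Fin K → F} (c : Fin T → F)
    (h : ∀ j, j ∉ S → v j = ∑ t, c t * H t j) : v ∈ rowUnitSpan F H S := by
  have hv : v = ∑ t, c t • H t +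
      ∑ j ∈ S, (v j - ∑ t, c t * H t j) • (Pi.single j (1 : F) : Fin K → F) := by
    ext k
    by_cases hk : k ∈ S
    · simp [Finset.sum_apply, Pi.single_apply, hk]
    · simp [Finset.sum_apply, Pi.single_apply, hk, h k hk]
  rw [hv]
  refine add_mem (sum_mem fun t _ => Submodule.smul_mem _ _ ?_)
    (sum_mem fun j hj => Submodule.smul_mem _ _ ?_)
  · exact Submodule.subset_span (Or.inl ⟨t, rfl⟩)
  · exact Submodule.subset_span (Or.inr ⟨j, hj, rfl⟩)

/-- Theorem 6: a parity check matrix `H` of a `(K,M)` MDS code (every `K - M` columns of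
`H` are linearly independent) satisfies the `(W,S)`-PIR-SI condition with side-information
size `M`. -/
theorem mds_gives_wsPirSi (F : Type*) [Field F] [Fintype F] {K M : ℕ}
    (hMK : M < K)
    (H : Matrix (Fin (K - M)) (Fin K) F)
    (hH : ∀ cols : Finset (Fin K), cols.card = K - M →
      LinearIndependent F (fun j : cols => (H.transpose (j : Fin K) : Fin (K - M) → F))) :
    ∀ S : Finset (Fin K), S.card = M → ∀ i : Fin K, i ∉ S →
      (Pi.single i 1 : Fin K → F) ∈ rowUnitSpan F H S := by
  intro S hS i hi
  have hcard : Sᶜ.card = K - M := by rw [Finset.card_compl, Fintype.card_fin, hS]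
  have : Nonempty (Sᶜ : Finset (Fin K)) := ⟨⟨i, Finset.mem_compl.2 hi⟩⟩
  let b := basisOfLinearIndependentOfCardEqFinrank (hH Sᶜ hcard)
    (by rw [Fintype.card_coe, hcard, Module.finrank_fin_fun])
  let f := b.coord ⟨i, Finset.mem_compl.2 hi⟩
  refine mem_rowUnitSpan_of_eq_sum_off (fun t => f (Pi.single t 1)) fun j hj => ?_
  have hb : b ⟨j, Finset.mem_compl.2 hj⟩ = H.transpose j := by simp [b]
  have hf : f (H.transpose j) = (Pi.single i 1 : Fin K → F) j := by
    rw [← hb, Module.Basis.coord_apply, Module.Basis.repr_self, Finsupp.single_apply,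
      Pi.single_apply]
    simp
  rw [← hf, LinearMap.pi_apply_eq_sum_univ f]
  refine Finset.sum_congr rfl fun t _ => ?_
  rw [smul_eq_mul, mul_comm, Matrix.transpose_apply]
  congr 2
  ext k
  simp [Pi.single_apply, eq_comm]
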